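/- For all Boolean normal monotonic (BNM) schemes 𝕏, 𝕏', 𝕏'' and for all 𝕄, ℕ belonging to the family {SS(𝕏)⋆, TT(𝕏')⋆, TS(𝕏'')⋆, SS(𝕏)⋆ ∪ TT(𝕏')⋆}: 𝕄 ⊆ ℕ if and only if T^d(𝕄 ∩ ℕ) = 𝕄. -/

import Mathlib

namespace ThreeValued

/-- Formulas of the propositional language: countably many variables,
negation, conjunction, disjunction. -/
inductive Fml : Type
  | var : ℕ → Fml
  | neg : Fml → Fml
  | conj : Fml → Fml → Fml
  | disj : Fml → Fml → Fml
deriving DecidableEq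

/-- An inference Γ ⇒ φ: a finite set of premises and a conclusion. -/
structure Infer : Type where
  prem : Finset Fml
  concl : Fml

/-- A set of inferences is closed under transitivity:
whenever there is a nonempty Δ with Δ ⇒ φ ∈ L and Γ ⇒ δ ∈ L for all δ ∈ Δ,
then Γ ⇒ φ ∈ L. -/
def TransClosed (L : Set Infer) : Prop :=
  ∀ (Γ Δ : Finset Fml) (φ : Fml), Δ.Nonempty →
    (⟨Δ, φ⟩ : Infer) ∈ L → (∀ δ ∈ Δ, (⟨Γ, δ⟩ : Infer) ∈ L) → (⟨Γ, φ⟩ : Infer) ∈ L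

/-- The transitive closure of a set of inferences: the least superset closed
under transitivity. -/
def T (L : Set Infer) : Set Infer := ⋂₀ {L' : Set Infer | L ⊆ L' ∧ TransClosed L'}

/-- A set of inferences is open under dual transitivity:
whenever there is a nonempty Δ with Δ ⇒ φ ∉ L and Γ ⇒ δ ∉ L for all δ ∈ Δ,
then Γ ⇒ φ ∉ L. -/
def DualTransClosed (L : Set Infer) : Prop :=
  ∀ (Γ Δ : Finset Fml) (φ : Fml), Δ.Nonempty →
    (⟨Δ, φ⟩ : Infer) ∉ L → (∀ δ ∈ Δ, (⟨Γ, δ⟩ : Infer) ∉ L) → (⟨Γ, φ⟩ : Infer) ∉ L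

/-- The dual transitive closure: the greatest subset open under dual
transitivity. -/
def Td (L : Set Infer) : Set Infer := ⋃₀ {L' : Set Infer | L' ⊆ L ∧ DualTransClosed L'}

/-- The three truth values 0, 1/2, 1. -/
inductive V3 : Type
  | zero | half | one
deriving DecidableEq

/-- A three-valued scheme: a triple of truth functions for ¬, ∧ and ∨. -/
structure Scheme : Type where
  fneg : V3 → V3
  fconj : V3 → V3 → V3
  fdisj : V3 → V3 → V3

/-- Boolean normality: on Boolean inputs the operations agree with the
classical ones. -/
def BooleanNormal (X : Scheme) : Prop :=
  X.fneg .zero = .one ∧ X.fneg .one = .zero ∧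
  X.fconj .one .one = .one ∧ X.fconj .one .zero = .zero ∧
  X.fconj .zero .one = .zero ∧ X.fconj .zero .zero = .zero ∧
  X.fdisj .one .one = .one ∧ X.fdisj .one .zero = .one ∧
  X.fdisj .zero .one = .one ∧ X.fdisj .zero .zero = .zero

/-- The information order: 1/2 is below 0 and below 1. -/
def infLe (a b : V3) : Prop := a = .half ∨ a = b

/-- Monotonicity of a scheme with respect to the information order. -/
def Monotonic (X : Scheme) : Prop :=
  (∀ a b, infLe a b → infLe (X.fneg a) (X.fneg b)) ∧
  (∀ a₁ a₂ b₁ b₂, infLe a₁ b₁ → infLe a₂ b₂ → infLe (X.fconj a₁ a₂) (X.fconj b₁ b₂)) ∧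
  (∀ a₁ a₂ b₁ b₂, infLe a₁ b₁ → infLe a₂ b₂ → infLe (X.fdisj a₁ a₂) (X.fdisj b₁ b₂))

/-- Boolean normal monotonic schemes. -/
def BNM (X : Scheme) : Prop := BooleanNormal X ∧ Monotonic X

/-- Valuations respecting a scheme. -/
def Respects (X : Scheme) (v : Fml → V3) : Prop :=
  (∀ φ, v (.neg φ) = X.fneg (v φ)) ∧
  (∀ φ ψ, v (.conj φ ψ) = X.fconj (v φ) (v ψ)) ∧
  (∀ φ ψ, v (.disj φ ψ) = X.fdisj (v φ) (v ψ))

/-- The strict formula-standard s = {1}. -/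
def sStd : Set V3 := {.one}

/-- The tolerant formula-standard t = {1, 1/2}. -/
def tStd : Set V3 := {.one, .half}

/-- An inference is xy-valid over a scheme X if every valuation respecting X
whose value on each premise is in x gives the conclusion a value in y. -/
def Valid (X : Scheme) (x y : Set V3) (I : Infer) : Prop :=
  ∀ v : Fml → V3, Respects X v → (∀ γ ∈ I.prem, v γ ∈ x) → v I.concl ∈ y

/-- The ss-valid inferences over X. -/
def SS (X : Scheme) : Set Infer := {I | Valid X sStd sStd I}

/-- The tt-valid inferences over X. -/
def TT (X : Scheme) : Set Infer := {I | Valid X tStd tStd I}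

/-- The st-valid inferences over X. -/
def ST (X : Scheme) : Set Infer := {I | Valid X sStd tStd I}

/-- The ts-valid inferences over X. -/
def TS (X : Scheme) : Set Infer := {I | Valid X tStd sStd I}

/-- Classical two-valued valuations. -/
def RespectsCL (v : Fml → Bool) : Prop :=
  (∀ φ, v (.neg φ) = ! v φ) ∧
  (∀ φ ψ, v (.conj φ ψ) = (v φ && v ψ)) ∧
  (∀ φ ψ, v (.disj φ ψ) = (v φ || v ψ))

/-- The classically valid inferences. -/
def CL : Set Infer :=
  {I | ∀ v : Fml → Bool, RespectsCL v → (∀ γ ∈ I.prem, v γ = true) → v I.concl = true}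

/-- Substitution: the homomorphic extension of a map from variables to
formulas. -/
def subst (σ : ℕ → Fml) : Fml → Fml
  | .var n => σ n
  | .neg φ => .neg (subst σ φ)
  | .conj φ ψ => .conj (subst σ φ) (subst σ ψ)
  | .disj φ ψ => .disj (subst σ φ) (subst σ ψ)

/-- Reflexivity. -/
def PropR (L : Set Infer) : Prop := ∀ φ : Fml, (⟨{φ}, φ⟩ : Infer) ∈ L

/-- Monotonicity (weakening). -/
def PropM (L : Set Infer) : Prop :=
  ∀ (Γ Sg : Finset Fml) (φ : Fml), (⟨Γ, φ⟩ : Infer) ∈ L → Γ ⊆ Sg → (⟨Sg, φ⟩ : Infer) ∈ L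

/-- Structurality (closure under substitutions). -/
def PropS (L : Set Infer) : Prop :=
  ∀ (Γ : Finset Fml) (φ : Fml), (⟨Γ, φ⟩ : Infer) ∈ L →
    ∀ σ : ℕ → Fml, (⟨Γ.image (subst σ), subst σ φ⟩ : Infer) ∈ L

/-- The Tarskian closure: the least superset satisfying (R), (M), (T), (S). -/
def Tar (L : Set Infer) : Set Infer :=
  ⋂₀ {L' : Set Infer | L ⊆ L' ∧ PropR L' ∧ PropM L' ∧ TransClosed L' ∧ PropS L'}

/-- L⋆: the inferences whose premise set is an antitheorem of L or whose
conclusion is a theorem of L. -/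
def starL (L : Set Infer) : Set Infer :=
  {I | (∀ ψ : Fml, (⟨I.prem, ψ⟩ : Infer) ∈ L) ∨ (∀ Δ : Finset Fml, (⟨Δ, I.concl⟩ : Infer) ∈ L)}

/-- The propositional variables occurring in a formula. -/
def fvars : Fml → Finset ℕ
  | .var n => {n}
  | .neg φ => fvars φ
  | .conj φ ψ => fvars φ ∪ fvars ψ
  | .disj φ ψ => fvars φ ∪ fvars ψ

/-- The dual transitive closure is contained in the original set. -/
theorem Td_subset (L : Set Infer) : Td L ⊆ L :=
  Set.sUnion_subset fun _ h => h.1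

/-- A set open under dual transitivity is its own dual transitive closure. -/
theorem DualTransClosed.Td_eq {L : Set Infer} (h : DualTransClosed L) : Td L = L :=
  (Td_subset L).antisymm (Set.subset_sUnion_of_mem ⟨subset_rfl, h⟩)

/-- `starL L` is open under dual transitivity, for every set of inferences `L`. -/
theorem dualTransClosed_starL (L : Set Infer) : DualTransClosed (starL L) := by
  rintro Γ Δ φ ⟨δ, hδ⟩ hφ hΓ (h | h)
  · exact hΓ δ hδ (Or.inl h)
  · exact hφ (Or.inr h)

/-- Sets open under dual transitivity are closed under binary unions. -/
theorem DualTransClosed.union {L L' : Set Infer} (h : DualTransClosed L)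
    (h' : DualTransClosed L') : DualTransClosed (L ∪ L') := by
  rintro Γ Δ φ hne hφ hΓ (hm | hm)
  · exact h Γ Δ φ hne (fun hh => hφ (Or.inl hh)) (fun δ hδ hh => hΓ δ hδ (Or.inl hh)) hm
  · exact h' Γ Δ φ hne (fun hh => hφ (Or.inr hh)) (fun δ hδ hh => hΓ δ hδ (Or.inr hh)) hm

/-- On the family {SS⋆, TT⋆, TS⋆, SS⋆ ∪ TT⋆}, inclusion is characterized by
the dual transitive closure of the intersection. -/
theorem stmt18 : ∀ X X' X'' : Scheme, BNM X → BNM X' → BNM X'' →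
    ∀ M N : Set Infer,
      M ∈ ({starL (SS X), starL (TT X'), starL (TS X''),
            starL (SS X) ∪ starL (TT X')} : Set (Set Infer)) →
      N ∈ ({starL (SS X), starL (TT X'), starL (TS X''),
            starL (SS X) ∪ starL (TT X')} : Set (Set Infer)) →
      (M ⊆ N ↔ Td (M ∩ N) = M) := by
  intro X X' X'' _ _ _ M N hM _
  have hM' : DualTransClosed M := by
    rcases hM with rfl | rfl | rfl | rfl
    · exact dualTransClosed_starL _
    · exact dualTransClosed_starL _
    · exact dualTransClosed_starL _
    · exact (dualTransClosed_starL _).union (dualTransClosed_starL _)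
  constructor
  · intro h
    rw [Set.inter_eq_left.mpr h, hM'.Td_eq]
  · intro h
    rw [← Set.inter_eq_left]
    exact Set.inter_subset_left.antisymm (h.symm.subset.trans (Td_subset _))

end ThreeValued
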